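/- arXiv:0806.0240 — 3 statements merged into one kernel-verified Lean document; each statement's English description precedes it below -/
import Mathlib

section
/- Suppose in addition: (i) for each x ∈ ℝ the family Π(x) is convex across capitals, i.e. for all α, β ≥ 0 with α + β = 1, π₁ ∈ Π(x₁) and π₂ ∈ Π(x₂) imply απ₁ + βπ₂ ∈ Π(αx₁ + βx₂); (ii) there is an integrable random variable Z with Z > 0 a.s. such that Z·G(π) is integrable and E[Z·G(π)] = 0 for every x and every π ∈ Π(x) (existence of a martingale measure); (iii) for every x > 0 and every π ∈ Π(x) the random variable U(·, x + G(π)) is integrable; (iv) for every x > 0 there exists an optimal strategy π*(x) ∈ Π(x), meaning E[U(x + G(π))] ≤ E[U(x + G(π*(x)))] for all π ∈ Π(x). Then the value function V(x) := E[U(x + G(π*(x)))] is strictly concave on the interval (0, ∞). -/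
open MeasureTheory

/-- The value function of a utility maximization problem with strictly concave
objective is strictly concave on `(0, ∞)`. -/
theorem value_function_strictConcaveOn
    {Ω : Type*} [MeasurableSpace Ω] (P : Measure Ω) [IsProbabilityMeasure P]
    {E : Type*} [AddCommGroup E] [Module ℝ E]
    (Adm : ℝ → Set E) (G : E →ₗ[ℝ] (Ω → ℝ))
    (hGmeas : ∀ π : E, Measurable (G π))
    (U : Ω × ℝ → ℝ) (hUmeas : Measurable U)
    (hUconc : ∀ ω : Ω, StrictConcaveOn ℝ Set.univ (fun x => U (ω, x)))
    (hconv : ∀ (α β x₁ x₂ : ℝ) (π₁ π₂ : E), 0 ≤ α → 0 ≤ β → α + β = 1 →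
      π₁ ∈ Adm x₁ → π₂ ∈ Adm x₂ → α • π₁ + β • π₂ ∈ Adm (α * x₁ + β * x₂))
    (Z : Ω → ℝ) (hZint : Integrable Z P) (hZpos : ∀ᵐ ω ∂P, 0 < Z ω)
    (hZmart : ∀ x : ℝ, ∀ π ∈ Adm x,
      Integrable (fun ω => Z ω * G π ω) P ∧ ∫ ω, Z ω * G π ω ∂P = 0)
    (hUint : ∀ x : ℝ, 0 < x → ∀ π ∈ Adm x,
      Integrable (fun ω => U (ω, x + G π ω)) P)
    (πstar : ℝ → E)
    (hopt : ∀ x : ℝ, 0 < x → πstar x ∈ Adm x ∧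
      ∀ π ∈ Adm x, ∫ ω, U (ω, x + G π ω) ∂P ≤ ∫ ω, U (ω, x + G (πstar x) ω) ∂P) :
    StrictConcaveOn ℝ (Set.Ioi (0 : ℝ))
      (fun x => ∫ ω, U (ω, x + G (πstar x) ω) ∂P) := by
  refine ⟨convex_Ioi 0, fun x hx y hy hxy a b ha hb hab => ?_⟩
  simp only [Set.mem_Ioi, smul_eq_mul] at hx hy ⊢
  have hxyab : 0 < a * x + b * y := by positivity
  obtain ⟨hmx, -⟩ := hopt x hx
  obtain ⟨hmy, -⟩ := hopt y hy
  have hmem := hconv a b x y _ _ ha.le hb.le hab hmx hmy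
  refine lt_of_lt_of_le ?_ ((hopt _ hxyab).2 _ hmem)
  have hcomb : ∀ ω, a * x + b * y + G (a • πstar x + b • πstar y) ω =
      a * (x + G (πstar x) ω) + b * (y + G (πstar y) ω) := fun ω => by
    simp only [map_add, map_smul, Pi.add_apply, Pi.smul_apply, smul_eq_mul]
    ring
  have hle : ∀ ω, a * U (ω, x + G (πstar x) ω) + b * U (ω, y + G (πstar y) ω) ≤
      U (ω, a * x + b * y + G (a • πstar x + b • πstar y) ω) := fun ω => by
    have h := (hUconc ω).concaveOn.2 (Set.mem_univ (x + G (πstar x) ω))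
      (Set.mem_univ (y + G (πstar y) ω)) ha.le hb.le hab
    simp only [smul_eq_mul] at h
    rwa [← hcomb ω] at h
  have hix := (hUint x hx _ hmx).const_mul a
  have hiy := (hUint y hy _ hmy).const_mul b
  have hi := hUint _ hxyab _ hmem
  rw [← integral_const_mul, ← integral_const_mul, ← integral_add hix hiy]
  refine lt_of_le_of_ne (integral_mono (hix.add hiy) hi hle) fun heq => hxy ?_
  have hae := (integral_eq_iff_of_ae_le (hix.add hiy) hi (ae_of_all _ hle)).1 heq
  have hwealth : ∀ᵐ ω ∂P, x + G (πstar x) ω = y + G (πstar y) ω := by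
    filter_upwards [hae] with ω hω
    by_contra hne
    have h := (hUconc ω).2 (Set.mem_univ (x + G (πstar x) ω))
      (Set.mem_univ (y + G (πstar y) ω)) hne ha hb hab
    simp only [smul_eq_mul] at h
    rw [← hcomb ω] at h
    exact h.ne hω
  have hbudget : ∀ z : ℝ, ∀ π ∈ Adm z, ∫ ω, Z ω * (z + G π ω) ∂P = (∫ ω, Z ω ∂P) * z :=
    fun z π hπ => by
      simp only [mul_add]
      rw [integral_add (hZint.mul_const z) (hZmart z π hπ).1, (hZmart z π hπ).2,
        integral_mul_const, add_zero]
  have hZ : 0 < ∫ ω, Z ω ∂P := by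
    rw [integral_pos_iff_support_of_nonneg_ae (hZpos.mono fun _ h => h.le) hZint,
      measure_congr (Filter.eventuallyEq_univ.2 (hZpos.mono fun _ h => h.ne') :
        Function.support Z =ᵐ[P] Set.univ)]
    simp
  refine mul_left_cancel₀ hZ.ne' ?_
  rw [← hbudget x _ hmx, ← hbudget y _ hmy]
  refine integral_congr_ae ?_
  filter_upwards [hwealth] with ω hω
  rw [hω]
end

section
/- Let (Ω, 𝓕, μ) be a probability space and H ⊆ G ⊆ 𝓕 sub-σ-algebras. Let I be a nonempty index set and (ξᵢ)_{i∈I} a family of integrable real random variables whose conditional expectations are upward directed at G: for all i, j ∈ I there exists k ∈ I with E(ξᵢ | G) ≤ E(ξ_k | G) a.s. and E(ξ_j | G) ≤ E(ξ_k | G) a.s. Suppose Y is an integrable G-measurable random variable which is an essential supremum of the family {E(ξᵢ | G) : i ∈ I}, i.e. E(ξᵢ | G) ≤ Y a.s. for every i ∈ I, and for every integrable G-measurable Z with E(ξᵢ | G) ≤ Z a.s. for all i ∈ I one has Y ≤ Z a.s. Then E(Y | H) is an essential supremum of the family {E(ξᵢ | H) : i ∈ I}: E(ξᵢ | H) ≤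 E(Y | H) a.s. for every i ∈ I, and for every integrable H-measurable W with E(ξᵢ | H) ≤ W a.s. for all i ∈ I one has E(Y | H) ≤ W a.s. -/
open MeasureTheory

open Filter Topology

/-- Finite suprema of an a.e. upward directed family are a.e. dominated by a member of it. -/
lemma exists_partialSups_ae_le_of_directed {Ω I : Type*} {m₀ : MeasurableSpace Ω} {μ : Measure Ω}
    {f : I → Ω → ℝ} (hdir : ∀ i j, ∃ k, f i ≤ᵐ[μ] f k ∧ f j ≤ᵐ[μ] f k) (a : ℕ → I) (n : ℕ) :
    ∃ k, partialSups (fun n ↦ f (a n)) n ≤ᵐ[μ] f k := by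
  induction n with
  | zero => exact ⟨a 0, by simp [EventuallyLE.refl]⟩
  | succ n ih =>
    obtain ⟨k, hk⟩ := ih
    obtain ⟨l, hkl, hal⟩ := hdir k (a (n + 1))
    refine ⟨l, ?_⟩
    rw [partialSups_add_one]
    filter_upwards [hk, hkl, hal] with x h₁ h₂ h₃
    exact sup_le (h₁.trans h₂) h₃

/-- An upward directed family of integrable functions with an integrable upper bound has a
measurable integrable upper bound whose integral is at most the supremum of the integrals of
the family. -/
lemma exists_integrable_upperBound_integral_le_iSup {Ω I : Type*} {G m₀ : MeasurableSpace Ω}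
    {μ : Measure Ω} (hG : G ≤ m₀) [Nonempty I] {f : I → Ω → ℝ}
    (hf : ∀ i, Integrable (f i) μ) (hfm : ∀ i, Measurable[G] (f i))
    (hdir : ∀ i j, ∃ k, f i ≤ᵐ[μ] f k ∧ f j ≤ᵐ[μ] f k)
    {Y : Ω → ℝ} (hY : Integrable Y μ) (hfY : ∀ i, f i ≤ᵐ[μ] Y) :
    ∃ F : Ω → ℝ, Integrable F μ ∧ Measurable[G] F ∧ (∀ i, f i ≤ᵐ[μ] F) ∧
      ∫ x, F x ∂μ ≤ ⨆ i, ∫ x, f i x ∂μ := by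
  have hbdd : BddAbove (Set.range fun i ↦ ∫ x, f i x ∂μ) :=
    ⟨∫ x, Y x ∂μ, by rintro _ ⟨i, rfl⟩; exact integral_mono_ae (hf i) hY (hfY i)⟩
  obtain ⟨u, -, hu, hurange⟩ := exists_seq_tendsto_sSup (Set.range_nonempty _) hbdd
  choose a ha using hurange
  set g : ℕ → Ω → ℝ := fun n ↦ partialSups (fun n ↦ f (a n)) n with hg
  have hgmono : Monotone g := fun m n h ↦ partialSups_monotone _ h
  have hgm (n) : Measurable[G] (g n) := by
    induction n with
    | zero => simpa [hg] using hfm (a 0)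
    | succ n ih => simpa [hg, partialSups_add_one] using ih.sup (hfm (a (n + 1)))
  have hgi (n) : Integrable (g n) μ := by
    induction n with
    | zero => simpa [hg] using hf (a 0)
    | succ n ih => simpa [hg, partialSups_add_one] using ih.sup (hf (a (n + 1)))
  have hgY : ∀ᵐ x ∂μ, ∀ n, g n x ≤ Y x := ae_all_iff.2 fun n ↦
    let ⟨k, hk⟩ := exists_partialSups_ae_le_of_directed hdir a n
    hk.trans (hfY k)
  set F : Ω → ℝ := fun x ↦ ⨆ n, g n x
  have hFm : Measurable[G] F := Measurable.iSup hgm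
  have hlim : ∀ᵐ x ∂μ, Tendsto (fun n ↦ g n x) atTop (𝓝 (F x)) := by
    filter_upwards [hgY] with x hx
    exact tendsto_atTop_ciSup (fun m n h ↦ hgmono h x) ⟨Y x, by rintro _ ⟨n, rfl⟩; exact hx n⟩
  have hFY : F ≤ᵐ[μ] Y := by
    filter_upwards [hgY] with x hx using ciSup_le hx
  have hgF : ∀ᵐ x ∂μ, ∀ n, g n x ≤ F x := by
    filter_upwards [hgY] with x hx n
    exact le_ciSup (f := fun n ↦ g n x) ⟨Y x, by rintro _ ⟨n, rfl⟩; exact hx n⟩ n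
  have hFi : Integrable F μ :=
    integrable_of_le_of_le (hFm.mono hG le_rfl).aestronglyMeasurable
      (hgF.mono fun x hx ↦ hx 0) hFY (hgi 0) hY
  have hsF : ⨆ i, ∫ x, f i x ∂μ ≤ ∫ x, F x ∂μ := by
    refine le_of_tendsto hu (Eventually.of_forall fun n ↦ ?_)
    rw [← ha n]
    refine integral_mono_ae (hf _) hFi ?_
    filter_upwards [hgF] with x hx
    exact (le_partialSups (fun n ↦ f (a n)) n x).trans (hx n)
  have hsup (j) : ∫ x, (F ⊔ f j) x ∂μ ≤ ⨆ i, ∫ x, f i x ∂μ := by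
    have hint : Tendsto (fun n ↦ ∫ x, (g n ⊔ f j) x ∂μ) atTop (𝓝 (∫ x, (F ⊔ f j) x ∂μ)) := by
      refine integral_tendsto_of_tendsto_of_monotone (fun n ↦ (hgi n).sup (hf j))
        (hFi.sup (hf j)) ?_ ?_
      · exact Eventually.of_forall fun x m n h ↦ sup_le_sup_right (hgmono h x) _
      · filter_upwards [hlim] with x hx
        exact hx.sup_nhds tendsto_const_nhds
    refine le_of_tendsto hint (Eventually.of_forall fun n ↦ ?_)
    obtain ⟨k, hk⟩ := exists_partialSups_ae_le_of_directed hdir a n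
    obtain ⟨l, hkl, hjl⟩ := hdir k j
    refine le_trans (integral_mono_ae ((hgi n).sup (hf j)) (hf l) ?_) (le_ciSup hbdd l)
    filter_upwards [hk, hkl, hjl] with x h₁ h₂ h₃
    exact sup_le (h₁.trans h₂) h₃
  refine ⟨F, hFi, hFm, fun j ↦ ?_, ?_⟩
  · have hle : F ≤ᵐ[μ] F ⊔ f j := Eventually.of_forall fun x ↦ le_sup_left
    have heq := (integral_eq_iff_of_ae_le hFi (hFi.sup (hf j)) hle).1
      (le_antisymm (integral_mono_ae hFi (hFi.sup (hf j)) hle) ((hsup j).trans hsF))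
    filter_upwards [heq] with x hx
    rw [hx]
    exact le_sup_right
  · obtain ⟨j⟩ := ‹Nonempty I›
    exact (integral_mono hFi (hFi.sup (hf j)) fun x ↦ le_sup_left).trans (hsup j)

/-- Tower property for essential suprema of upward directed families of conditional
expectations: if `Y` is an essential supremum of `{E(ξᵢ|G)}`, then `E(Y|H)` is an
essential supremum of `{E(ξᵢ|H)}` for a smaller σ-algebra `H ⊆ G`. -/
theorem condexp_essSup_tower
    {Ω : Type*} {m₀ : MeasurableSpace Ω} (μ : Measure Ω) [IsProbabilityMeasure μ]
    {H G : MeasurableSpace Ω} (hHG : H ≤ G) (hG : G ≤ m₀)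
    {I : Type*} [Nonempty I] (ξ : I → Ω → ℝ) (hξ : ∀ i, Integrable (ξ i) μ)
    (hdir : ∀ i j : I, ∃ k : I,
      (μ[ξ i|G] ≤ᵐ[μ] μ[ξ k|G]) ∧ (μ[ξ j|G] ≤ᵐ[μ] μ[ξ k|G]))
    (Y : Ω → ℝ) (hYint : Integrable Y μ) (hYmeas : StronglyMeasurable[G] Y)
    (hYub : ∀ i : I, μ[ξ i|G] ≤ᵐ[μ] Y)
    (hYlub : ∀ Z : Ω → ℝ, Integrable Z μ → StronglyMeasurable[G] Z →
      (∀ i : I, μ[ξ i|G] ≤ᵐ[μ] Z) → Y ≤ᵐ[μ] Z) :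
    (∀ i : I, μ[ξ i|H] ≤ᵐ[μ] μ[Y|H]) ∧
      (∀ W : Ω → ℝ, Integrable W μ → StronglyMeasurable[H] W →
        (∀ i : I, μ[ξ i|H] ≤ᵐ[μ] W) → μ[Y|H] ≤ᵐ[μ] W) := by
  have hfi (i) : Integrable (μ[ξ i|G]) μ := integrable_condExp
  have htower (i) : μ[μ[ξ i|G]|H] =ᵐ[μ] μ[ξ i|H] := condExp_condExp_of_le hHG hG
  refine ⟨fun i ↦ (htower i).symm.le.trans (condExp_mono (hfi i) hYint (hYub i)),
    fun W hW _ hξW ↦ ?_⟩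
  obtain ⟨F, hFi, hFm, hfF, hFs⟩ := exists_integrable_upperBound_integral_le_iSup hG hfi
    (fun i ↦ stronglyMeasurable_condExp.measurable) hdir hYint hYub
  have hYs : ∫ x, Y x ∂μ ≤ ⨆ i, ∫ x, (μ[ξ i|G]) x ∂μ :=
    (integral_mono_ae hYint hFi (hYlub F hFi hFm.stronglyMeasurable hfF)).trans hFs
  have hpos : Integrable (μ[Y|H] ⊔ W - W) μ := (integrable_condExp.sup hW).sub hW
  have hnonneg : 0 ≤ μ[Y|H] ⊔ W - W := sub_nonneg.2 le_sup_right
  have hbound (i) : ∫ x, (μ[ξ i|G]) x ∂μ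
      ≤ ∫ x, Y x ∂μ - ∫ x, (μ[Y|H] ⊔ W - W) x ∂μ := by
    have h : μ[Y|H] ⊔ W - W ≤ᵐ[μ] μ[Y|H] - μ[ξ i|H] := by
      filter_upwards [hξW i, condExp_mono (m := H) (hfi i) hYint (hYub i), htower i]
        with x h₁ h₂ h₃
      simp only [Pi.sub_apply, Pi.sup_apply]
      rw [h₃] at h₂
      rcases le_total ((μ[Y|H]) x) (W x) with h | h
      · rw [sup_eq_right.2 h]; linarith
      · rw [sup_eq_left.2 h]; linarith
    have hle := integral_mono_ae hpos (integrable_condExp.sub integrable_condExp) h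
    rw [integral_sub' integrable_condExp integrable_condExp, integral_condExp (hHG.trans hG),
      integral_condExp (hHG.trans hG)] at hle
    rw [integral_condExp hG]
    linarith
  have hzero : ∫ x, (μ[Y|H] ⊔ W - W) x ∂μ = 0 := by
    have := hYs.trans (ciSup_le hbound)
    exact le_antisymm (by linarith) (integral_nonneg hnonneg)
  filter_upwards [(integral_eq_zero_iff_of_nonneg hnonneg hpos).1 hzero] with x hx
  exact le_sup_left.trans (sub_eq_zero.1 hx).le
end

section
/- Let (Ω, 𝓕, μ) be a probability space and H ⊆ G ⊆ 𝓕 sub-σ-algebras. Let I be a nonempty index set, J ⊆ I nonempty, and (ξᵢ)_{i∈I} a family of integrable real random variables such that the subfamily {E(ξ_j | G) : j ∈ J} is upward directed at G (for all j₁, j₂ ∈ J there is j₃ ∈ J with E(ξ_{j₁} | G) ≤ E(ξ_{j₃} | G) a.s. and E(ξ_{j₂} | G) ≤ E(ξ_{j₃} | G) a.s.). Suppose Y_G is an integrable G-measurable essential supremum of {E(ξ_j | G) : j ∈ J}, and Y_H is an integrable H-measurable random variable with E(ξᵢ | H) ≤ Y_H a.s. for every i ∈ I. Then E(Y_G | H)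 ≤ Y_H almost surely. -/
open MeasureTheory

/-- For an upward directed family of integrable functions measurable with respect to `G`, the
integral of an integrable essential supremum is the supremum of the integrals. -/
lemma isLUB_integral_of_directed_essSup {Ω ι : Type*} {m₀ : MeasurableSpace Ω} {μ : Measure Ω}
    {G : MeasurableSpace Ω} (hG : G ≤ m₀) [Nonempty ι] {f : ι → Ω → ℝ}
    (hint : ∀ i, Integrable (f i) μ) (hmeas : ∀ i, StronglyMeasurable[G] (f i))
    (hdir : ∀ i j, ∃ k, f i ≤ᵐ[μ] f k ∧ f j ≤ᵐ[μ] f k)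
    {Y : Ω → ℝ} (hY : Integrable Y μ) (hub : ∀ i, f i ≤ᵐ[μ] Y)
    (hlub : ∀ Z : Ω → ℝ, Integrable Z μ → StronglyMeasurable[G] Z →
      (∀ i, f i ≤ᵐ[μ] Z) → Y ≤ᵐ[μ] Z) :
    IsLUB (Set.range fun i ↦ ∫ ω, f i ω ∂μ) (∫ ω, Y ω ∂μ) := by
  have hbdd : (∫ ω, Y ω ∂μ) ∈ upperBounds (Set.range fun i ↦ ∫ ω, f i ω ∂μ) := by
    rintro _ ⟨i, rfl⟩
    exact integral_mono_ae (hint i) hY (hub i)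
  refine ⟨hbdd, fun b hb ↦ ?_⟩
  obtain ⟨s, hs⟩ : ∃ s, IsLUB (Set.range fun i ↦ ∫ ω, f i ω ∂μ) s :=
    ⟨_, isLUB_csSup (Set.range_nonempty _) ⟨_, hbdd⟩⟩
  obtain ⟨x, -, -, hx, hxmem⟩ := hs.exists_seq_monotone_tendsto (Set.range_nonempty _)
  choose v hv using hxmem
  choose d hd₁ hd₂ using hdir
  let u : ℕ → ι := fun n ↦ Nat.rec (v 0) (fun n i ↦ d i (v (n + 1))) n
  have hvu : ∀ n, f (v n) ≤ᵐ[μ] f (u n)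
    | 0 => Filter.EventuallyLE.refl _ _
    | n + 1 => hd₂ (u n) (v (n + 1))
  have hmono : ∀ᵐ ω ∂μ, Monotone fun n ↦ f (u n) ω := by
    have h : ∀ n, f (u n) ≤ᵐ[μ] f (u (n + 1)) := fun n ↦ hd₁ (u n) (v (n + 1))
    filter_upwards [ae_all_iff.2 h] with ω hω using monotone_nat_of_le_succ hω
  have hus : Filter.Tendsto (fun n ↦ ∫ ω, f (u n) ω ∂μ) Filter.atTop (nhds s) := by
    refine tendsto_of_tendsto_of_tendsto_of_le_of_le hx tendsto_const_nhds (fun n ↦ ?_)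
      fun n ↦ hs.1 ⟨u n, rfl⟩
    rw [← hv n]
    exact integral_mono_ae (hint _) (hint _) (hvu n)
  let Z : Ω → ℝ := fun ω ↦ ⨆ n, f (u n) ω
  have hZmeas : StronglyMeasurable[G] Z :=
    (Measurable.iSup fun n ↦ (hmeas (u n)).measurable).stronglyMeasurable
  have huY : ∀ᵐ ω ∂μ, ∀ n, f (u n) ω ≤ Y ω := ae_all_iff.2 fun n ↦ hub (u n)
  have hlim : ∀ᵐ ω ∂μ, Filter.Tendsto (fun n ↦ f (u n) ω) Filter.atTop (nhds (Z ω)) := by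
    filter_upwards [hmono, huY] with ω hω hωY
    exact tendsto_atTop_ciSup hω ⟨Y ω, by rintro _ ⟨n, rfl⟩; exact hωY n⟩
  have hZint : Integrable Z μ := by
    refine integrable_of_le_of_le (hZmeas.mono hG).aestronglyMeasurable ?_ ?_ (hint (u 0)) hY
    · filter_upwards [hmono, hlim] with ω hω hωZ using hω.ge_of_tendsto hωZ 0
    · filter_upwards [hlim, huY] with ω hωZ hωY using le_of_tendsto' hωZ hωY
  have hZs : ∫ ω, Z ω ∂μ = s :=
    tendsto_nhds_unique
      (integral_tendsto_of_tendsto_of_monotone (fun n ↦ hint (u n)) hZint hmono hlim) hus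
  have hfZ : ∀ i, f i ≤ᵐ[μ] Z := by
    intro i
    have hmax : ∫ ω, max (Z ω) (f i ω) ∂μ ≤ s := by
      refine le_of_tendsto' (integral_tendsto_of_tendsto_of_monotone
        (f := fun n ω ↦ max (f (u n) ω) (f i ω)) (fun n ↦ (hint (u n)).sup (hint i))
        (hZint.sup (hint i)) ?_ ?_) fun n ↦ ?_
      · filter_upwards [hmono] with ω hω m n hmn using max_le_max_right _ (hω hmn)
      · filter_upwards [hlim] with ω hω using hω.max tendsto_const_nhds
      · refine le_trans (integral_mono_ae ((hint (u n)).sup (hint i)) (hint (d (u n) i)) ?_)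
          (hs.1 ⟨d (u n) i, rfl⟩)
        filter_upwards [hd₁ (u n) i, hd₂ (u n) i] with ω h₁ h₂ using max_le h₁ h₂
    have hle : Z ≤ᵐ[μ] fun ω ↦ max (Z ω) (f i ω) := ae_of_all _ fun ω ↦ le_max_left _ _
    have heq := (integral_eq_iff_of_ae_le hZint (hZint.sup (hint i)) hle).1
      (le_antisymm (integral_mono_ae hZint (hZint.sup (hint i)) hle) (hmax.trans_eq hZs.symm))
    filter_upwards [heq] with ω hω
    exact (le_max_right _ _).trans_eq hω.symm
  calc ∫ ω, Y ω ∂μ ≤ ∫ ω, Z ω ∂μ := integral_mono_ae hY hZint (hlub Z hZint hZmeas hfZ)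
    _ = s := hZs
    _ ≤ b := hs.2 hb

/-- Abstract supermartingale property of the value process: if `Y_G` is an essential
supremum of the conditional expectations (at `G`) over the smaller strategy family `J`,
and `Y_H` dominates all conditional expectations (at `H`) over the larger family `I`,
then `E(Y_G | H) ≤ Y_H` a.s. -/
theorem condexp_essSup_superm
    {Ω : Type*} {m₀ : MeasurableSpace Ω} (μ : Measure Ω) [IsProbabilityMeasure μ]
    {H G : MeasurableSpace Ω} (hHG : H ≤ G) (hG : G ≤ m₀)
    {I : Type*} [Nonempty I] (J : Set I) (hJ : J.Nonempty)
    (ξ : I → Ω → ℝ) (hξ : ∀ i, Integrable (ξ i) μ)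
    (hdir : ∀ j₁ ∈ J, ∀ j₂ ∈ J, ∃ j₃ ∈ J,
      (μ[ξ j₁|G] ≤ᵐ[μ] μ[ξ j₃|G]) ∧ (μ[ξ j₂|G] ≤ᵐ[μ] μ[ξ j₃|G]))
    (YG : Ω → ℝ) (hYGint : Integrable YG μ) (hYGmeas : StronglyMeasurable[G] YG)
    (hYGub : ∀ j ∈ J, μ[ξ j|G] ≤ᵐ[μ] YG)
    (hYGlub : ∀ Z : Ω → ℝ, Integrable Z μ → StronglyMeasurable[G] Z →
      (∀ j ∈ J, μ[ξ j|G] ≤ᵐ[μ] Z) → YG ≤ᵐ[μ] Z)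
    (YH : Ω → ℝ) (hYHint : Integrable YH μ) (hYHmeas : StronglyMeasurable[H] YH)
    (hYHub : ∀ i : I, μ[ξ i|H] ≤ᵐ[μ] YH) :
    μ[YG|H] ≤ᵐ[μ] YH := by
  have : Nonempty J := hJ.to_subtype
  have hLUB := isLUB_integral_of_directed_essSup (μ := μ) hG (f := fun j : J ↦ μ[ξ j|G])
    (fun _ ↦ integrable_condExp) (fun _ ↦ stronglyMeasurable_condExp)
    (fun j₁ j₂ ↦ by
      obtain ⟨j₃, hj₃, h⟩ := hdir j₁ j₁.2 j₂ j₂.2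
      exact ⟨⟨j₃, hj₃⟩, h⟩)
    hYGint (fun j ↦ hYGub j j.2) (fun Z hZ hZm h ↦ hYGlub Z hZ hZm fun j hj ↦ h ⟨j, hj⟩)
  have hDint : Integrable (fun ω ↦ max ((μ[YG|H]) ω - YH ω) 0) μ :=
    (integrable_condExp.sub hYHint).pos_part
  have hD : ∀ j : J, ∫ ω, max ((μ[YG|H]) ω - YH ω) 0 ∂μ
      ≤ ∫ ω, YG ω ∂μ - ∫ ω, (μ[ξ j|G]) ω ∂μ := by
    intro j
    rw [← integral_condExp (hHG.trans hG) (f := YG), integral_condExp hG,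
      ← integral_condExp (hHG.trans hG) (f := ξ j),
      ← integral_sub integrable_condExp integrable_condExp]
    refine integral_mono_ae hDint (integrable_condExp.sub integrable_condExp) ?_
    filter_upwards [hYHub j, condExp_condExp_of_le (μ := μ) (f := ξ j) hHG hG,
      condExp_mono (m := H) integrable_condExp hYGint (hYGub j j.2)] with ω h₁ h₂ h₃
    rw [h₂] at h₃
    exact max_le (sub_le_sub_left h₁ _) (sub_nonneg.2 h₃)
  have hzero : ∫ ω, max ((μ[YG|H]) ω - YH ω) 0 ∂μ ≤ 0 := by
    have := hLUB.2 (show ∫ ω, YG ω ∂μ - ∫ ω, max ((μ[YG|H]) ω - YH ω) 0 ∂μ ∈ _ by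
      rintro _ ⟨j, rfl⟩
      exact le_sub_comm.1 (hD j))
    linarith
  have hnonneg : 0 ≤ᵐ[μ] fun ω ↦ max ((μ[YG|H]) ω - YH ω) 0 :=
    ae_of_all _ fun ω ↦ le_max_right _ _
  have hae := (integral_eq_zero_iff_of_nonneg_ae hnonneg hDint).1
    (le_antisymm hzero (integral_nonneg_of_ae hnonneg))
  filter_upwards [hae] with ω hω
  exact sub_nonpos.1 ((le_max_left _ _).trans_eq hω)
end
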